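/- Let K be a number field and let A be a nonempty finite subset of Kˣ whose elements lie in pairwise distinct squareclasses (for distinct a, a' ∈ A, the quotient a/a' is not a square in K). Then there exist a natural number m ≤ |A| − 1, nonzero prime ideals v₁, …, v_m of 𝓞_K, and group homomorphisms λ_i : (K_{v_i})ˣ → ℤ/2ℤ such that the map sending a ∈ A to the tuple (λ_i(image of a in K_{v_i}))_{i=1,…,m} ∈ (ℤ/2ℤ)^m is injective on A. -/

import Mathlib

open IsDedekindDomain NumberField

open Filter Topology in
/-- The Dirichlet series of the Dedekind zeta function converges for `s > 1` close to `1`. -/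
theorem NumberField.eventually_lseriesSummable_card_ideal (K : Type*) [Field K] [NumberField K] :
    ∀ᶠ s : ℝ in 𝓝[>] 1, LSeriesSummable
      (fun n ↦ (Nat.card {I : Ideal (𝓞 K) // Ideal.absNorm I = n} : ℂ)) (s : ℂ) := by
  have := (tendsto_sub_one_mul_dedekindZeta_nhdsGT K).eventually_ne
    (Complex.ofReal_ne_zero.mpr (dedekindZeta_residue_ne_zero K))
  filter_upwards [this] with s hs
  by_contra hns
  exact hs (by rw [dedekindZeta, LSeries.eq_zero_of_not_LSeriesSummable _ _ hns, mul_zero])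

open Filter Topology in
/-- An inequality between ideal counts that would force `ζ_K(s)² ≤ ζ_L(s)` near `s = 1` cannot
hold, as `ζ_L` has only a simple pole there. -/
theorem NumberField.not_sum_card_ideal_mul_le (K L : Type*) [Field K] [NumberField K] [Field L]
    [NumberField L] :
    ¬ ∀ n : ℕ, n ≠ 0 → ∑ p ∈ n.divisorsAntidiagonal,
      Nat.card {I : Ideal (𝓞 K) // Ideal.absNorm I = p.1} *
        Nat.card {I : Ideal (𝓞 K) // Ideal.absNorm I = p.2} ≤
      Nat.card {I : Ideal (𝓞 L) // Ideal.absNorm I = n} := by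
  intro h
  have hK := tendsto_sub_one_mul_dedekindZeta_nhdsGT K
  have hL := tendsto_sub_one_mul_dedekindZeta_nhdsGT L
  have hKpos := dedekindZeta_residue_pos K
  have hle : ∀ᶠ s : ℝ in 𝓝[>] 1,
      ((((s : ℂ) - 1) * dedekindZeta K s) ^ 2).re ≤
        ((s : ℂ) - 1).re * (((s : ℂ) - 1) * dedekindZeta L s).re := by
    filter_upwards [eventually_lseriesSummable_card_ideal K,
      eventually_lseriesSummable_card_ideal L] with s hsK hsL
    have hterm : (dedekindZeta K s * dedekindZeta K s).re ≤ (dedekindZeta L s).re := by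
      simp only [dedekindZeta]
      rw [← LSeries_convolution' hsK hsK, LSeries, LSeries,
        Complex.re_tsum (hsK.convolution hsK), Complex.re_tsum hsL]
      refine Summable.tsum_le_tsum (fun n ↦ ?_) (Complex.reCLM.summable (hsK.convolution hsK))
        (Complex.reCLM.summable hsL)
      rcases eq_or_ne n 0 with rfl | hn
      · simp
      · rw [LSeries.term_of_ne_zero hn, LSeries.term_of_ne_zero hn, LSeries.convolution_def]
        have hpow : ((n : ℂ) ^ (s : ℂ)) = (((n : ℝ) ^ s : ℝ) : ℂ) := by
          rw [Complex.ofReal_cpow (Nat.cast_nonneg n), Complex.ofReal_natCast]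
        rw [hpow, Complex.div_ofReal_re, Complex.div_ofReal_re]
        refine div_le_div_of_nonneg_right ?_ (by positivity)
        simp only [← Nat.cast_mul, ← Nat.cast_sum, Complex.natCast_re]
        exact Nat.cast_le.mpr (h n hn)
    have e1 : (((s : ℂ) - 1) * dedekindZeta K s) ^ 2 =
        (((s - 1) ^ 2 : ℝ) : ℂ) * (dedekindZeta K s * dedekindZeta K s) := by
      push_cast; ring
    have e2 : ((s : ℂ) - 1) * dedekindZeta L s = ((s - 1 : ℝ) : ℂ) * dedekindZeta L s := by
      push_cast; ring
    have e3 : ((s : ℂ) - 1).re = s - 1 := by simp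
    rw [e1, e2, e3, Complex.re_ofReal_mul, Complex.re_ofReal_mul, ← mul_assoc, ← sq (s - 1)]
    exact mul_le_mul_of_nonneg_left hterm (sq_nonneg _)
  have l1 := (Complex.continuous_re.tendsto _).comp (hK.pow 2)
  have l0 : Tendsto (fun s : ℝ ↦ ((s : ℂ) - 1).re) (𝓝[>] 1) (𝓝 0) := by
    have : Continuous fun s : ℝ ↦ ((s : ℂ) - 1).re := by fun_prop
    simpa using (this.tendsto 1).mono_left nhdsWithin_le_nhds
  have l2 := l0.mul ((Complex.continuous_re.tendsto _).comp hL)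
  have := le_of_tendsto_of_tendsto l1 l2 hle
  rw [zero_mul, ← Complex.ofReal_pow, Complex.ofReal_re] at this
  exact absurd this (not_le.mpr (by positivity))

open UniqueFactorizationMonoid in
/-- If every prime of `K` has two primes of relative degree one above it in `L`, then pairs of
nonzero ideals of `K` embed multiplicatively in norm into the ideals of `L`. -/
theorem NumberField.exists_ideal_prod_injOn {K L : Type*} [Field K] [NumberField K] [Field L]
    [NumberField L] [Algebra (𝓞 K) (𝓞 L)]
    (h : ∀ v : HeightOneSpectrum (𝓞 K), ∃ P Q : HeightOneSpectrum (𝓞 L), P ≠ Q ∧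
      P.asIdeal.comap (algebraMap (𝓞 K) (𝓞 L)) = v.asIdeal ∧
      Q.asIdeal.comap (algebraMap (𝓞 K) (𝓞 L)) = v.asIdeal ∧
      Ideal.absNorm P.asIdeal = Ideal.absNorm v.asIdeal ∧
      Ideal.absNorm Q.asIdeal = Ideal.absNorm v.asIdeal) :
    ∃ F : Ideal (𝓞 K) × Ideal (𝓞 K) → Ideal (𝓞 L),
      Set.InjOn F {x | x.1 ≠ 0 ∧ x.2 ≠ 0} ∧ ∀ x, x.1 ≠ 0 → x.2 ≠ 0 →
        Ideal.absNorm (F x) = Ideal.absNorm x.1 * Ideal.absNorm x.2 := by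
  classical
  have h' : ∀ v : Ideal (𝓞 K), ∃ P Q : Ideal (𝓞 L), Prime v → (Prime P ∧ Prime Q ∧ P ≠ Q ∧
      P.comap (algebraMap (𝓞 K) (𝓞 L)) = v ∧ Q.comap (algebraMap (𝓞 K) (𝓞 L)) = v ∧
      Ideal.absNorm P = Ideal.absNorm v ∧ Ideal.absNorm Q = Ideal.absNorm v) := by
    intro v
    by_cases hv : Prime v
    · obtain ⟨P, Q, hPQ, h1, h2, h3, h4⟩ := h ⟨v, Ideal.isPrime_of_prime hv, hv.ne_zero⟩
      exact ⟨P.asIdeal, Q.asIdeal, fun _ ↦ ⟨P.prime, Q.prime,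
        fun e ↦ hPQ (HeightOneSpectrum.ext e), h1, h2, h3, h4⟩⟩
    · exact ⟨⊥, ⊥, fun h ↦ absurd h hv⟩
  choose P Q hPQ using h'
  let c : Ideal (𝓞 L) → Ideal (𝓞 K) := Ideal.comap (algebraMap (𝓞 K) (𝓞 L))
  let m : Ideal (𝓞 K) × Ideal (𝓞 K) → Multiset (Ideal (𝓞 L)) := fun x ↦
    (normalizedFactors x.1).map P + (normalizedFactors x.2).map Q
  have hprime (I : Ideal (𝓞 K)) : ∀ v ∈ normalizedFactors I, Prime v :=
    fun v hv ↦ prime_of_normalized_factor v hv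
  have hm (x) : ∀ p ∈ m x, Prime p := by
    intro p hp
    rcases Multiset.mem_add.mp hp with hp | hp <;> obtain ⟨v, hv, rfl⟩ := Multiset.mem_map.mp hp
    exacts [(hPQ v (hprime _ v hv)).1, (hPQ v (hprime _ v hv)).2.1]
  have hfactors (x) : normalizedFactors (m x).prod = m x := normalizedFactors_prod_of_prime (hm x)
  have hleft (x) : ((m x).filter fun p ↦ p = P (c p)).map c = normalizedFactors x.1 := by
    rw [Multiset.filter_add, Multiset.filter_eq_self.mpr, Multiset.filter_eq_nil.mpr, add_zero,
      Multiset.map_map]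
    · conv_rhs => rw [← Multiset.map_id (normalizedFactors x.1)]
      exact Multiset.map_congr rfl fun v hv ↦ (hPQ v (hprime _ v hv)).2.2.2.1
    · intro p hp e
      obtain ⟨v, hv, rfl⟩ := Multiset.mem_map.mp hp
      have := hPQ v (hprime _ v hv)
      rw [show c (Q v) = v from this.2.2.2.2.1] at e
      exact this.2.2.1 e.symm
    · intro p hp
      obtain ⟨v, hv, rfl⟩ := Multiset.mem_map.mp hp
      rw [show c (P v) = v from (hPQ v (hprime _ v hv)).2.2.2.1]
  have hright (x) : ((m x).filter fun p ↦ ¬ p = P (c p)).map c = normalizedFactors x.2 := by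
    rw [Multiset.filter_add, Multiset.filter_eq_nil.mpr, Multiset.filter_eq_self.mpr, zero_add,
      Multiset.map_map]
    · conv_rhs => rw [← Multiset.map_id (normalizedFactors x.2)]
      exact Multiset.map_congr rfl fun v hv ↦ (hPQ v (hprime _ v hv)).2.2.2.2.1
    · intro p hp e
      obtain ⟨v, hv, rfl⟩ := Multiset.mem_map.mp hp
      have := hPQ v (hprime _ v hv)
      rw [show c (Q v) = v from this.2.2.2.2.1] at e
      exact this.2.2.1 e.symm
    · intro p hp
      obtain ⟨v, hv, rfl⟩ := Multiset.mem_map.mp hp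
      rw [not_not, show c (P v) = v from (hPQ v (hprime _ v hv)).2.2.2.1]
  have hnormalized {I : Ideal (𝓞 K)} (hI : I ≠ 0) : (normalizedFactors I).prod = I :=
    Ideal.prod_normalizedFactors_eq_self hI
  have hnorm (x : Ideal (𝓞 K) × Ideal (𝓞 K)) (h1 : x.1 ≠ 0) (h2 : x.2 ≠ 0) :
      Ideal.absNorm (m x).prod = Ideal.absNorm x.1 * Ideal.absNorm x.2 := by
    conv_rhs => rw [← hnormalized h1, ← hnormalized h2]
    simp only [m, Multiset.prod_add, map_mul, map_multiset_prod, Multiset.map_map]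
    congr 2 <;> refine Multiset.map_congr rfl fun v hv ↦ ?_
    exacts [(hPQ v (hprime _ v hv)).2.2.2.2.2.1, (hPQ v (hprime _ v hv)).2.2.2.2.2.2]
  refine ⟨fun x ↦ (m x).prod, fun x hx y hy hxy ↦ ?_, hnorm⟩
  have hmm : m x = m y := by rw [← hfactors, ← hfactors y]; exact congrArg _ hxy
  ext1
  · rw [← hnormalized hx.1, ← hnormalized hy.1, ← hleft x, hmm, hleft y]
  · rw [← hnormalized hx.2, ← hnormalized hy.2, ← hright x, hmm, hright y]

/-- A map on pairs that is injective over a set `S` of pairs of sizes bounds the number of such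
pairs by the size of a fiber of its target. -/
theorem Nat.sum_card_fiber_mul_card_fiber_le {α β : Type*} (N : α → ℕ) (N' : β → ℕ)
    (F : α × α → β) (S : Finset (ℕ × ℕ)) (n : ℕ) (hα : ∀ d, Finite {a // N a = d})
    (hβ : Finite {b // N' b = n}) (hF : Set.InjOn F {x | (N x.1, N x.2) ∈ S})
    (hN : ∀ x, (N x.1, N x.2) ∈ S → N' (F x) = n) :
    ∑ p ∈ S, Nat.card {a // N a = p.1} * Nat.card {a // N a = p.2} ≤
      Nat.card {b // N' b = n} := by
  have hcard : ∑ p ∈ S, Nat.card {a // N a = p.1} * Nat.card {a // N a = p.2} =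
      Nat.card (Σ p : S, {a // N a = p.1.1} × {a // N a = p.1.2}) := by
    rw [Nat.card_sigma, ← Finset.sum_coe_sort]
    simp only [Nat.card_prod]
  rw [hcard]
  refine Nat.card_le_card_of_injective
    (fun x ↦ ⟨F (x.2.1.1, x.2.2.1), hN _ ?_⟩) ?_
  · obtain ⟨⟨p, hp⟩, ⟨a, ha⟩, ⟨b, hb⟩⟩ := x
    simpa [ha, hb] using hp
  · rintro ⟨⟨⟨d, e⟩, hp⟩, ⟨a, ha⟩, ⟨b, hb⟩⟩ ⟨⟨⟨d', e'⟩, hp'⟩, ⟨a', ha'⟩, ⟨b', hb'⟩⟩ heq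
    obtain rfl : d = N a := ha.symm
    obtain rfl : e = N b := hb.symm
    obtain rfl : d' = N a' := ha'.symm
    obtain rfl : e' = N b' := hb'.symm
    obtain ⟨rfl, rfl⟩ := Prod.mk.inj (hF hp hp' (Subtype.mk.inj heq))
    rfl

/-- A norm-multiplicative embedding of pairs of nonzero ideals of `K` into ideals of `L` bounds the
Dirichlet convolution square of the ideal counts of `K` by the ideal counts of `L`. -/
theorem NumberField.sum_card_ideal_mul_le {K L : Type*} [Field K] [NumberField K] [Field L]
    [NumberField L] {F : Ideal (𝓞 K) × Ideal (𝓞 K) → Ideal (𝓞 L)}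
    (hF : Set.InjOn F {x | x.1 ≠ 0 ∧ x.2 ≠ 0})
    (hnorm : ∀ x, x.1 ≠ 0 → x.2 ≠ 0 →
      Ideal.absNorm (F x) = Ideal.absNorm x.1 * Ideal.absNorm x.2) {n : ℕ} (hn : n ≠ 0) :
    ∑ p ∈ n.divisorsAntidiagonal,
      Nat.card {I : Ideal (𝓞 K) // Ideal.absNorm I = p.1} *
        Nat.card {I : Ideal (𝓞 K) // Ideal.absNorm I = p.2} ≤
      Nat.card {I : Ideal (𝓞 L) // Ideal.absNorm I = n} := by
  have hne {x : Ideal (𝓞 K) × Ideal (𝓞 K)}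
      (hx : (Ideal.absNorm x.1, Ideal.absNorm x.2) ∈ n.divisorsAntidiagonal) :
      x.1 ≠ 0 ∧ x.2 ≠ 0 := by
    have hx := (Nat.mem_divisorsAntidiagonal.mp hx).1
    constructor <;> intro h0 <;> refine hn ?_ <;> simpa [h0] using hx.symm
  refine Nat.sum_card_fiber_mul_card_fiber_le _ _ F _ n
    (fun d ↦ Ideal.finite_setOfPred_absNorm_eq d) (Ideal.finite_setOfPred_absNorm_eq n)
    (hF.mono fun x hx ↦ hne hx) fun x hx ↦ ?_
  rw [hnorm x (hne hx).1 (hne hx).2]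
  exact (Nat.mem_divisorsAntidiagonal.mp hx).1

/-- Over `𝔽₂`, linear functionals detect non-squares. -/
theorem exists_monoidHom_zmod_two_ne_one {G : Type*} [CommGroup G] {u : G} (hu : ¬ IsSquare u) :
    ∃ f : G →* Multiplicative (ZMod 2), f u ≠ 1 := by
  let H : AddSubgroup (Additive G) := (powMonoidHom 2 : G →* G).range.toAddSubgroup
  let _ : Module (ZMod 2) (Additive G ⧸ H) :=
    QuotientAddGroup.zmodModule fun x ↦ ⟨x.toMul, rfl⟩
  have hne : (QuotientAddGroup.mk (Additive.ofMul u) : Additive G ⧸ H) ≠ 0 := by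
    rw [ne_eq, QuotientAddGroup.eq_zero_iff]
    rintro ⟨y, hy⟩
    exact hu ⟨y, by rw [← sq]; exact hy.symm⟩
  obtain ⟨g, hg⟩ := not_forall.mp (mt (Module.forall_dual_apply_eq_zero_iff (ZMod 2) _).mp hne)
  exact ⟨AddMonoidHom.toMultiplicativeRight
    (g.toAddMonoidHom.comp (QuotientAddGroup.mk' H)), fun e ↦ hg e⟩

/-- A family of functions separating a finite set `A` contains at most `#A - 1` members that
already separate `A`. -/
theorem Finset.exists_fin_injOn_of_separating {α ι β : Type*} (A : Finset α)
    (f : ι → α → β) (h : ∀ a ∈ A, ∀ b ∈ A, a ≠ b → ∃ i, f i a ≠ f i b) :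
    ∃ m ≤ A.card - 1, ∃ t : Fin m → ι, Set.InjOn (fun a j ↦ f (t j) a) (A : Set α) := by
  classical
  induction A using Finset.induction_on with
  | empty => exact ⟨0, le_rfl, Fin.elim0, by simp⟩
  | insert a s ha ih =>
    obtain ⟨m, hm, t, ht⟩ := ih fun x hx y hy ↦
      h x (mem_insert_of_mem hx) y (mem_insert_of_mem hy)
    rw [card_insert_of_notMem ha, Nat.add_sub_cancel]
    by_cases hb : ∃ b ∈ s, (fun j ↦ f (t j) a) = fun j ↦ f (t j) b
    · obtain ⟨b, hbs, hb⟩ := hb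
      obtain ⟨i, hi⟩ := h a (mem_insert_self a s) b (mem_insert_of_mem hbs)
        (fun e ↦ ha (e ▸ hbs))
      have hpos : 0 < s.card := card_pos.mpr ⟨b, hbs⟩
      refine ⟨m + 1, by omega, Fin.cons i t, ?_⟩
      have hnew (c) (hc : c ∈ s)
          (e : (fun j ↦ f ((Fin.cons i t : Fin (m + 1) → ι) j) a) =
            fun j ↦ f ((Fin.cons i t : Fin (m + 1) → ι) j) c) : False := by
        have hcb : c = b := ht hc hbs <| by
          refine Eq.trans ?_ hb
          exact funext fun j ↦ by simpa using (congrFun e j.succ).symm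
        exact hi (by simpa [hcb] using congrFun e 0)
      intro x hx y hy e
      rcases mem_insert.mp hx with rfl | hxs <;> rcases mem_insert.mp hy with rfl | hys
      · rfl
      · exact (hnew y hys e).elim
      · exact (hnew x hxs e.symm).elim
      · exact ht hxs hys (funext fun j ↦ by simpa using congrFun e j.succ)
    · push Not at hb
      refine ⟨m, by omega, t, ?_⟩
      rw [coe_insert, Set.injOn_insert (mod_cast ha)]
      exact ⟨ht, fun ⟨b, hbs, e⟩ ↦ hb b hbs e.symm⟩

theorem IsDedekindDomain.HeightOneSpectrum.valued_algebraMap_adicCompletion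
    {R K : Type*} [CommRing R] [IsDedekindDomain R] [Field K] [Algebra R K] [IsFractionRing R K]
    (v : HeightOneSpectrum R) (k : K) :
    Valued.v (algebraMap K (v.adicCompletion K) k) = v.valuation K k :=
  v.valuedAdicCompletion_eq_valuation' k

/-- Elements of a completion are approximated arbitrarily well by elements of the field. -/
theorem IsDedekindDomain.HeightOneSpectrum.exists_valued_sub_algebraMap_lt
    {R K : Type*} [CommRing R] [IsDedekindDomain R] [Field K] [Algebra R K] [IsFractionRing R K]
    (v : HeightOneSpectrum R) {x y : v.adicCompletion K} (hy : y ≠ 0) :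
    ∃ k : K, Valued.v (x - algebraMap K (v.adicCompletion K) k) < Valued.v y := by
  have hopen : IsOpen {z : v.adicCompletion K | Valued.v (x - z) < Valued.v y} := by
    have hball : IsOpen {z : v.adicCompletion K | Valued.v z < Valued.v y} := by
      simpa only [Valuation.restrict_lt_iff] using
        Valued.isOpen_ball (v.adicCompletion K) (Valued.v.restrict y)
    exact hball.preimage (continuous_const.sub continuous_id)
  obtain ⟨k, hk⟩ := (HeightOneSpectrum.denseRange_algebraMap (K := K) v).exists_mem_open hopen
    ⟨x, by simpa [zero_lt_iff] using hy⟩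
  exact ⟨k, hk⟩

/-- Embeddings in a completion map algebraic integers to local integers. -/
theorem NumberField.RingOfIntegers.valued_map_le_one {K L : Type*} [Field K] [NumberField K]
    [Field L] [Algebra K L] {v : HeightOneSpectrum (𝓞 K)}
    (φ : L →ₐ[K] v.adicCompletion K) (x : 𝓞 L) :
    Valued.v (φ (algebraMap (𝓞 L) L x)) ≤ 1 := by
  have h : IsIntegral (𝓞 K) (φ (algebraMap (𝓞 L) L x)) :=
    (x.isIntegral_coe.tower_top (A := 𝓞 K)).map (φ.restrictScalars (𝓞 K))
  have : IsScalarTower (𝓞 K) (v.adicCompletionIntegers K) (v.adicCompletion K) :=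
    .of_algebraMap_eq fun _ ↦ rfl
  have h2 : IsIntegral (v.adicCompletionIntegers K) (φ (algebraMap (𝓞 L) L x)) := h.tower_top
  exact (HeightOneSpectrum.adicCompletionIntegers.integers K v).isIntegral_iff_v_le_one.mp h2

/-- The prime of `L` cut out by an embedding of `L` in a completion of `K`. -/
theorem NumberField.exists_heightOneSpectrum_of_algHom_adicCompletion {K L : Type*} [Field K]
    [NumberField K] [Field L] [NumberField L] [Algebra K L] {v : HeightOneSpectrum (𝓞 K)}
    (φ : L →ₐ[K] v.adicCompletion K) :
    ∃ P : HeightOneSpectrum (𝓞 L),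
      (∀ x : 𝓞 L, x ∈ P.asIdeal ↔ Valued.v (φ (algebraMap (𝓞 L) L x)) < 1) ∧
      P.asIdeal.comap (algebraMap (𝓞 K) (𝓞 L)) = v.asIdeal ∧
      Ideal.absNorm P.asIdeal = Ideal.absNorm v.asIdeal := by
  let I : Ideal (𝓞 L) :=
    { carrier := {x | Valued.v (φ (algebraMap (𝓞 L) L x)) < 1}
      zero_mem' := by simp
      add_mem' := fun {a b} ha hb ↦ by
        simp only [Set.mem_ofPred_eq, map_add] at *
        exact Valuation.map_add_lt _ ha hb
      smul_mem' := fun c x hx ↦ by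
        simp only [Set.mem_ofPred_eq, smul_eq_mul, map_mul] at *
        exact mul_lt_one_of_nonneg_of_lt_one_right
          (RingOfIntegers.valued_map_le_one φ c) zero_le hx }
  have hI (x : 𝓞 L) : x ∈ I ↔ Valued.v (φ (algebraMap (𝓞 L) L x)) < 1 := Iff.rfl
  have hφ (r : 𝓞 K) : φ (algebraMap (𝓞 L) L (algebraMap (𝓞 K) (𝓞 L) r)) =
      algebraMap K (v.adicCompletion K) (algebraMap (𝓞 K) K r) := φ.commutes (r : K)
  have hcomap : I.comap (algebraMap (𝓞 K) (𝓞 L)) = v.asIdeal := by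
    ext r
    rw [Ideal.mem_comap, hI, hφ, v.valued_algebraMap_adicCompletion, v.valuation_lt_one_iff_mem]
  have hprime : I.IsPrime := by
    refine ⟨fun h ↦ ?_, fun {x y} hxy ↦ ?_⟩
    · have : (1 : 𝓞 L) ∈ I := h ▸ Submodule.mem_top
      simp [hI] at this
    · by_contra! hne
      simp only [hI, not_lt] at hne hxy
      rw [map_mul, map_mul, map_mul,
        le_antisymm (RingOfIntegers.valued_map_le_one φ x) hne.1,
        le_antisymm (RingOfIntegers.valued_map_le_one φ y) hne.2] at hxy
      simp at hxy
  have hbot : I ≠ ⊥ := by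
    intro h
    refine v.ne_bot ?_
    rw [← hcomap, h]
    exact (RingHom.injective_iff_ker_eq_bot _).mp (FaithfulSMul.algebraMap_injective (𝓞 K) (𝓞 L))
  refine ⟨⟨I, hprime, hbot⟩, hI, hcomap, ?_⟩
  let f : 𝓞 K →+* 𝓞 L ⧸ I := (Ideal.Quotient.mk I).comp (algebraMap (𝓞 K) (𝓞 L))
  have hker : RingHom.ker f = v.asIdeal := by
    rw [← hcomap, ← RingHom.comap_ker, Ideal.mk_ker]
  have hsurj : Function.Surjective f := by
    intro x
    obtain ⟨x, rfl⟩ := Ideal.Quotient.mk_surjective x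
    obtain ⟨k, hk⟩ := v.exists_valued_sub_algebraMap_lt (x := φ (algebraMap (𝓞 L) L x))
      (one_ne_zero)
    rw [map_one] at hk
    have hk1 : v.valuation K k ≤ 1 := by
      rw [← v.valued_algebraMap_adicCompletion]
      have := Valuation.map_sub_le (v := Valued.v) (RingOfIntegers.valued_map_le_one φ x) hk.le
      rwa [sub_sub_cancel] at this
    obtain ⟨r, hr⟩ := v.exists_valuation_sub_lt_of_integer hk1 1
    refine ⟨r, Ideal.Quotient.eq.mpr ?_⟩
    rw [hI, map_sub, map_sub, hφ]
    rw [← v.valued_algebraMap_adicCompletion, map_sub] at hr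
    rw [Valuation.map_sub_swap] at hk
    have := Valuation.map_add_lt _ hr hk
    rwa [sub_add_sub_cancel] at this
  rw [Ideal.absNorm_apply, Ideal.absNorm_apply, Submodule.cardQuot_apply, Submodule.cardQuot_apply]
  exact (Nat.card_congr ((Ideal.quotEquivOfEq hker.symm).trans
    (RingHom.quotientKerEquivOfSurjective hsurj)).toEquiv).symm

/-- The two embeddings of `K(√c)` in a completion of `K` cut out distinct primes. -/
theorem NumberField.heightOneSpectrum_ne_of_algHom_neg {K L : Type*} [Field K] [NumberField K]
    [Field L] [NumberField L] [Algebra K L] {v : HeightOneSpectrum (𝓞 K)} {α : L} {c : K}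
    (hα : α ^ 2 = algebraMap K L c)
    (hc : ¬ IsSquare c) {φ ψ : L →ₐ[K] v.adicCompletion K} (hφψ : ψ α = - φ α)
    {P Q : HeightOneSpectrum (𝓞 L)}
    (hP : ∀ x : 𝓞 L, x ∈ P.asIdeal ↔ Valued.v (φ (algebraMap (𝓞 L) L x)) < 1)
    (hQ : ∀ x : 𝓞 L, x ∈ Q.asIdeal ↔ Valued.v (ψ (algebraMap (𝓞 L) L x)) < 1) : P ≠ Q := by
  rintro rfl
  have hα0 : α ≠ 0 := by
    rintro rfl
    refine hc ⟨0, ?_⟩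
    rw [zero_pow two_ne_zero, eq_comm, map_eq_zero] at hα
    simp [hα]
  have : CharZero (v.adicCompletion K) := charZero_of_injective_algebraMap
    (algebraMap K (v.adicCompletion K)).injective
  have hs0 : φ α ≠ 0 := (map_ne_zero φ).mpr hα0
  have h2s : 2 * φ α ≠ 0 := mul_ne_zero two_ne_zero hs0
  obtain ⟨k, hk⟩ := v.exists_valued_sub_algebraMap_lt (x := φ α) h2s
  have hplus : Valued.v (φ α + algebraMap K (v.adicCompletion K) k) = Valued.v (2 * φ α) := by
    rw [← Valuation.map_sub_eq_of_lt_right _ hk, Valuation.map_sub_swap]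
    congr 1; ring
  have hαk (ε : K) (hε : ε ^ 2 = 1) : α - algebraMap K L (ε * k) ≠ 0 := by
    intro h
    refine hc ⟨k, (algebraMap K L).injective ?_⟩
    rw [← hα, sub_eq_zero.mp h, ← map_pow, mul_pow, hε, one_mul, sq]
  have h1 : α - algebraMap K L k ≠ 0 := by simpa using hαk 1 (by simp)
  have h2 : α + algebraMap K L k ≠ 0 := by simpa using hαk (-1) (by simp)
  set x : L := (α - algebraMap K L k) / (α + algebraMap K L k) with hx
  have hx0 : x ≠ 0 := div_ne_zero h1 h2
  have hφx : Valued.v (φ x) < 1 := by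
    rw [hx, map_div₀, map_div₀, map_sub, map_add, AlgHom.commutes, hplus]
    exact (div_lt_one₀ (zero_lt_iff.mpr (by simpa using h2s))).mpr hk
  have hψx : ψ x = (φ x)⁻¹ := by
    rw [hx, map_div₀, map_div₀, map_sub, map_add, map_sub, map_add, AlgHom.commutes,
      AlgHom.commutes, hφψ, inv_div, ← neg_div_neg_eq]
    congr 1 <;> ring
  have hψx' : 1 < Valued.v (ψ x) := by
    rw [hψx, map_inv₀]
    exact (one_lt_inv₀ (zero_lt_iff.mpr (by simpa using hx0))).mpr hφx
  obtain ⟨n, ⟨d, hd⟩, h | h⟩ := P.exists_primeCompl_mul_eq_or_mul_eq (K := L) x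
  · have hd1 := le_antisymm (RingOfIntegers.valued_map_le_one ψ d) (not_lt.mp (mt (hQ d).mpr hd))
    have := RingOfIntegers.valued_map_le_one ψ n
    rw [← h, map_mul, map_mul, hd1, mul_one] at this
    exact this.not_gt hψx'
  · have hd1 := not_lt.mp (mt (hP d).mpr hd)
    rw [← h, map_mul, map_mul] at hd1
    exact hd1.not_gt (mul_lt_one_of_nonneg_of_lt_one_left zero_le hφx
      (RingOfIntegers.valued_map_le_one φ n))
open Polynomial in
/-- A nonsquare in a number field stays a nonsquare in some nonarchimedean completion. -/
theorem NumberField.exists_not_isSquare_adicCompletion {K : Type*} [Field K] [NumberField K]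
    {c : K} (hc : ¬ IsSquare c) :
    ∃ v : HeightOneSpectrum (𝓞 K), ¬ IsSquare (algebraMap K (v.adicCompletion K) c) := by
  by_contra! hsq
  let p : K[X] := X ^ 2 - C c
  have hirr : Irreducible p :=
    X_pow_sub_C_irreducible_of_prime Nat.prime_two fun b hb ↦ hc ⟨b, by rw [← sq, hb]⟩
  have : Fact (Irreducible p) := ⟨hirr⟩
  let L := AdjoinRoot p
  have : FiniteDimensional K L := (AdjoinRoot.powerBasis hirr.ne_zero).finite
  have : CharZero L := charZero_of_injective_algebraMap (algebraMap K L).injective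
  have : NumberField L := { to_finiteDimensional := Module.Finite.trans K L }
  have hα : (AdjoinRoot.root p : L) ^ 2 = algebraMap K L c := by
    have := AdjoinRoot.eval₂_root p
    rw [eval₂_sub, eval₂_X_pow, eval₂_C] at this
    exact sub_eq_zero.mp this
  obtain ⟨F, hF, hnorm⟩ := exists_ideal_prod_injOn (K := K) (L := L) fun v ↦ by
    obtain ⟨s, hs⟩ := hsq v
    let φ : L →ₐ[K] v.adicCompletion K := AdjoinRoot.liftAlgHom p (Algebra.ofId _ _) s
      (by simp [p, hs, sq])
    let ψ : L →ₐ[K] v.adicCompletion K := AdjoinRoot.liftAlgHom p (Algebra.ofId _ _) (-s)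
      (by simp [p, hs, sq])
    have hφψ : ψ (AdjoinRoot.root p) = -φ (AdjoinRoot.root p) := by
      rw [AdjoinRoot.liftAlgHom_root, AdjoinRoot.liftAlgHom_root]
    obtain ⟨P, hP, hPv, hPn⟩ := exists_heightOneSpectrum_of_algHom_adicCompletion φ
    obtain ⟨Q, hQ, hQv, hQn⟩ := exists_heightOneSpectrum_of_algHom_adicCompletion ψ
    exact ⟨P, Q, heightOneSpectrum_ne_of_algHom_neg hα hc hφψ hP hQ, hPv, hQv, hPn, hQn⟩
  exact not_sum_card_ideal_mul_le K L fun n hn ↦ sum_card_ideal_mul_le hF hnorm hn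

/-- (Finite-test-set separation.) Let `K` be a number field and `A` a
nonempty finite subset of `Kˣ` whose elements lie in pairwise distinct squareclasses. Then
there are `m ≤ |A| - 1`, nonzero primes `v₁, …, v_m` of `𝓞_K`, and group homomorphisms
`λᵢ : (K_{vᵢ})ˣ → ℤ/2ℤ` such that `a ↦ (λᵢ(a))ᵢ` is injective on `A`. -/
theorem stmt_12 (K : Type*) [Field K] [NumberField K] (A : Finset Kˣ) (hA : A.Nonempty)
    (hsep : ∀ a ∈ A, ∀ a' ∈ A, a ≠ a' → ¬ IsSquare ((a : K) / (a' : K))) :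
    ∃ m : ℕ, m ≤ A.card - 1 ∧
      ∃ (v : Fin m → HeightOneSpectrum (𝓞 K))
        (lam : ∀ i : Fin m, ((v i).adicCompletion K)ˣ →* Multiplicative (ZMod 2)),
        Set.InjOn (fun a : Kˣ => fun i : Fin m =>
          Multiplicative.toAdd ((lam i) (Units.map
            (algebraMap K ((v i).adicCompletion K)).toMonoidHom a))) (A : Set Kˣ) := by
  let ι := Σ v : HeightOneSpectrum (𝓞 K), (v.adicCompletion K)ˣ →* Multiplicative (ZMod 2)
  obtain ⟨m, hm, t, ht⟩ := A.exists_fin_injOn_of_separating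
    (fun (i : ι) a ↦ Multiplicative.toAdd (i.2 (Units.map
      (algebraMap K (i.1.adicCompletion K)).toMonoidHom a))) fun a ha b hb hab ↦ by
    obtain ⟨v, hv⟩ := exists_not_isSquare_adicCompletion (hsep a ha b hb hab)
    let g : Kˣ →* (v.adicCompletion K)ˣ :=
      Units.map (algebraMap K (v.adicCompletion K)).toMonoidHom
    have hu : ¬ IsSquare (g (a / b)) := by
      rintro ⟨y, hy⟩
      refine hv ⟨y, ?_⟩
      have := congrArg Units.val hy
      simpa [g] using this
    obtain ⟨f, hf⟩ := exists_monoidHom_zmod_two_ne_one hu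
    refine ⟨⟨v, f⟩, fun e ↦ hf ?_⟩
    rw [map_div, map_div, div_eq_one]
    exact Multiplicative.toAdd.injective e
  exact ⟨m, hm, fun i ↦ (t i).1, fun i ↦ (t i).2, ht⟩
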